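/- Let d ≥ 1, let T* < T be natural numbers, let σ_DP, C, κ, r* > 0, and let φ_{T*}, …, φ_{T−1}, φ* ∈ ℝ^d satisfy 0 < ‖φ_t − φ*‖ < r* for all T* ≤ t ≤ T−1. For each coordinate i ∈ {1,…,d}, set S_i = Σ_{t=T*}^{T−1} (φ_t^(i) − φ*^(i))² and assume S_i > 0, and define e_std > 0 by e_std² = max_{1≤i≤d} σ_DP²C²/(κ²S_i) (the largest variance of the maximum-likelihood estimators of the diagonal Hessian entries). Then e_std · r* ≥ (1/κ) · √(d/(T−T*)) · σ_DP · C. -/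

import Mathlib

open MeasureTheory Finset

/-- Theorem 2 of the paper: trade-off between the variance of the MLE of the
diagonal Hessian entries and the spread of the DP-SGD trace around the optimum. -/
theorem hessian_variance_trace_tradeoff
    {d : ℕ} (hd : 1 ≤ d)
    (Tstar T : ℕ) (hT : Tstar < T)
    (σDP C κ rstar : ℝ)
    (hσ : 0 < σDP) (hC : 0 < C) (hκ : 0 < κ) (hr : 0 < rstar)
    (φ : ℕ → EuclideanSpace ℝ (Fin d)) (φstar : EuclideanSpace ℝ (Fin d))
    (hnorm : ∀ t ∈ Finset.Ico Tstar T,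
      0 < ‖φ t - φstar‖ ∧ ‖φ t - φstar‖ < rstar)
    (S : Fin d → ℝ)
    (hS : ∀ i, S i = ∑ t ∈ Finset.Ico Tstar T, (φ t i - φstar i) ^ 2)
    (hSpos : ∀ i, 0 < S i)
    (estd : ℝ) (hestd : 0 < estd)
    (hestd2 : estd ^ 2 =
      Finset.univ.sup' (Finset.univ_nonempty_iff.mpr ⟨⟨0, hd⟩⟩)
        (fun i : Fin d => σDP ^ 2 * C ^ 2 / (κ ^ 2 * S i))) :
    estd * rstar ≥ (1 / κ) * Real.sqrt ((d : ℝ) / ((T : ℝ) - (Tstar : ℝ))) * (σDP * C) := by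
  have h1 : ∀ i, σDP ^ 2 * C ^ 2 ≤ estd ^ 2 * κ ^ 2 * S i := by
    intro i
    have h : σDP ^ 2 * C ^ 2 / (κ ^ 2 * S i) ≤ estd ^ 2 := by
      rw [hestd2]
      exact Finset.le_sup' (fun i : Fin d => σDP ^ 2 * C ^ 2 / (κ ^ 2 * S i)) (Finset.mem_univ i)
    have hp : 0 < κ ^ 2 * S i := mul_pos (by positivity) (hSpos i)
    rw [div_le_iff₀ hp] at h
    linarith
  have hN : (0 : ℝ) < (T : ℝ) - (Tstar : ℝ) := sub_pos.mpr (by exact_mod_cast hT)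
  have h2 : ∑ i, S i ≤ ((T : ℝ) - Tstar) * rstar ^ 2 := by
    simp only [hS]
    rw [Finset.sum_comm]
    have h : ∀ t ∈ Finset.Ico Tstar T, ∑ i, (φ t i - φstar i) ^ 2 ≤ rstar ^ 2 := by
      intro t ht
      have e : ‖φ t - φstar‖ ^ 2 = ∑ i, (φ t i - φstar i) ^ 2 := by
        simp [EuclideanSpace.norm_sq_eq]
      rw [← e]
      exact pow_le_pow_left₀ (norm_nonneg _) (hnorm t ht).2.le 2
    have h' := Finset.sum_le_sum h
    rw [Finset.sum_const, Nat.card_Ico, nsmul_eq_mul, Nat.cast_sub hT.le] at h'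
    exact h'
  have h3 : (d : ℝ) * (σDP ^ 2 * C ^ 2) ≤ estd ^ 2 * κ ^ 2 * (((T : ℝ) - Tstar) * rstar ^ 2) := by
    have h := Finset.sum_le_sum (fun i (_ : i ∈ Finset.univ) => h1 i)
    rw [Finset.sum_const, Finset.card_univ, Fintype.card_fin, nsmul_eq_mul, ← Finset.mul_sum] at h
    exact h.trans (mul_le_mul_of_nonneg_left h2 (by positivity))
  have h4 : Real.sqrt ((d : ℝ) / ((T : ℝ) - (Tstar : ℝ))) ≤ κ * estd * rstar / (σDP * C) := by
    apply Real.sqrt_le_iff.mpr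
    refine ⟨by positivity, ?_⟩
    rw [div_pow, div_le_div_iff₀ hN (by positivity)]
    nlinarith [h3]
  rw [le_div_iff₀ (by positivity)] at h4
  rw [ge_iff_le, mul_assoc, one_div, inv_mul_le_iff₀ hκ]
  linarith
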